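/- Fix an integer r ≥ 3. There is a constant c = c(r) > 0 such that the following holds for every n ≥ 2 divisible by r, every r-graph H on an n-element vertex set V having at least one perfect matching, and every random (not necessarily uniform) perfect matching f of H: H(f) ≤ (1/r)·∑_{v∈V} H(f(v)) − (r−1)n/r + c·( ∑_{v∈V} ∑_{Y} p_v(Y)·γ_v(Y)^{1/(r−1)} + log n ), where the inner sum runs over all (r−1)-subsets Y of V∖{v}. -/

import Mathlib

open Finset

/-- The set of perfect matchings of the `r`-graph `H` on vertex set `V`. -/
def pmSet (V : Finset ℕ) (H : Finset (Finset ℕ)) : Finset (Finset (Finset ℕ)) :=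
  H.powerset.filter (fun M => (∀ A ∈ M, ∀ B ∈ M, A ≠ B → A ∩ B = ∅) ∧ M.biUnion id = V)

/-- The number of perfect matchings of `H`. -/
def pmCount (V : Finset ℕ) (H : Finset (Finset ℕ)) : ℕ := (pmSet V H).card

/-- All `r`-element subsets of `[n]`. -/
def Kn (n r : ℕ) : Finset (Finset ℕ) := Finset.powersetCard r (Finset.range n)

/-- `edgeAt M v` is the edge of the matching `M` containing `v` (denoted `f_v`). -/
def edgeAt (M : Finset (Finset ℕ)) (v : ℕ) : Finset ℕ := (M.filter (fun A => v ∈ A)).sup id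

/-- `p_v(Y) = P(f(v) = Y)`: the probability, under the distribution `p` on perfect
matchings of `H`, that the edge containing `v`, minus `v`, equals `Y`. -/
noncomputable def pv (V : Finset ℕ) (H : Finset (Finset ℕ)) (p : Finset (Finset ℕ) → ℝ)
    (v : ℕ) (Y : Finset ℕ) : ℝ :=
  ∑ M ∈ (pmSet V H).filter (fun M => (edgeAt M v).erase v = Y), p M

/-- `γ_v(Y)`: the probability that fewer than `r-1` edges of the random matching,
other than the edge of `v`, meet `Y`. -/
noncomputable def gammav (r : ℕ) (V : Finset ℕ) (H : Finset (Finset ℕ))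
    (p : Finset (Finset ℕ) → ℝ) (v : ℕ) (Y : Finset ℕ) : ℝ :=
  ∑ M ∈ (pmSet V H).filter
      (fun M => (M.filter (fun B => B ≠ edgeAt M v ∧ (B ∩ Y).Nonempty)).card < r - 1), p M

noncomputable section EntAux

/-- Probability of the class of `M` when the edges at `S` are revealed. -/
def mcl {α : Type} [DecidableEq α] (P : Finset α) (p : α → ℝ) (e : α → ℕ → Finset ℕ)
    (S : Finset ℕ) (M : α) : ℝ :=
  ∑ M' ∈ P.filter (fun M' => ∀ w ∈ S, e M' w = e M w), p M'

/-- Joint entropy of the edges at `S`. -/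
def hent {α : Type} [DecidableEq α] (P : Finset α) (p : α → ℝ) (e : α → ℕ → Finset ℕ)
    (S : Finset ℕ) : ℝ :=
  - ∑ M ∈ P, p M * Real.log (mcl P p e S M)

theorem mcl_pos {α : Type} [DecidableEq α] (P : Finset α) (p : α → ℝ) (e : α → ℕ → Finset ℕ)
    (hp : ∀ M ∈ P, 0 ≤ p M) (S : Finset ℕ) (M : α) (hM : M ∈ P) (h : 0 < p M) :
    0 < mcl P p e S M := by
  unfold mcl
  refine lt_of_lt_of_le h ?_
  refine Finset.single_le_sum (f := p) (fun i hi => hp i (Finset.mem_filter.1 hi).1) ?_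
  simp [hM]

theorem key_ineq {α : Type} [DecidableEq α] (V : Finset ℕ) (P : Finset α) (p : α → ℝ)
    (e : α → ℕ → Finset ℕ) (hp : ∀ M ∈ P, 0 ≤ p M)
    (he1 : ∀ M ∈ P, ∀ v ∈ V, v ∈ e M v)
    (he2 : ∀ M ∈ P, ∀ v ∈ V, ∀ w ∈ e M v, w ∈ V ∧ e M w = e M v)
    (v : ℕ) (hv : v ∈ V) (S : Finset ℕ) (hS : S ⊆ V.erase v)
    (w : Finset ℕ → ℝ) (hw : ∀ Y, 0 ≤ w Y)
    (Ys : Finset (Finset ℕ)) (hYs : ∀ M ∈ P, (e M v).erase v ∈ Ys) :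
    ∑ M ∈ P.filter (fun M => Disjoint (e M v) S),
        p M * (w ((e M v).erase v) * mcl P p e S M / mcl P p e (insert v S) M) ≤
      ∑ M ∈ P.filter (fun M => Disjoint (e M v) S),
        p M * ∑ Y ∈ Ys.filter (fun Y => Disjoint ((insert v Y).biUnion (e M)) S), w Y := by
  have hSV : ∀ x ∈ S, x ∈ V := fun x hx => (Finset.mem_erase.1 (hS hx)).2
  -- relation invariance
  have inv : ∀ M ∈ P, ∀ M' ∈ P, (∀ x ∈ S, e M x = e M' x) → Disjoint (e M v) S →
      Disjoint (e M' v) S := by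
    intro M hM M' hM' hr hd
    rw [Finset.disjoint_left] at hd ⊢
    intro x hx hxS
    have h1 := (he2 M' hM' v hv x hx).2
    have h2 := hr x hxS
    have hvx : v ∈ e M x := by rw [h2, h1]; exact he1 M' hM' v hv
    have h3 := (he2 M hM x (hSV x hxS) v hvx).2
    exact hd (h3 ▸ he1 M hM x (hSV x hxS)) hxS
  calc ∑ M ∈ P.filter (fun M => Disjoint (e M v) S),
        p M * (w ((e M v).erase v) * mcl P p e S M / mcl P p e (insert v S) M)
      = ∑ M ∈ P.filter (fun M => Disjoint (e M v) S),
          ∑ M' ∈ P.filter (fun M' => ∀ x ∈ S, e M' x = e M x),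
            p M' * (p M * w ((e M v).erase v) / mcl P p e (insert v S) M) := by
        refine Finset.sum_congr rfl fun M hM => ?_
        rw [← Finset.sum_mul]
        unfold mcl
        ring
    _ = ∑ M' ∈ P.filter (fun M => Disjoint (e M v) S),
          ∑ M ∈ P.filter (fun M => ∀ x ∈ S, e M x = e M' x),
            p M' * (p M * w ((e M v).erase v) / mcl P p e (insert v S) M) := by
        refine Finset.sum_comm' ?_
        intro M M'
        simp only [Finset.mem_filter]
        constructor
        · rintro ⟨⟨h1, h2⟩, h3, h4⟩
          exact ⟨⟨h1, fun x hx => (h4 x hx).symm⟩, h3,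
            inv M h1 M' h3 (fun x hx => (h4 x hx).symm) h2⟩
        · rintro ⟨⟨h1, h2⟩, h3, h4⟩
          exact ⟨⟨h1, inv M' h3 M h1 (fun x hx => (h2 x hx).symm) h4⟩, h3,
            fun x hx => (h2 x hx).symm⟩
    _ ≤ _ := by
        refine Finset.sum_le_sum fun M' hM' => ?_
        obtain ⟨hM', hd'⟩ := Finset.mem_filter.1 hM'
        rw [← Finset.mul_sum]
        refine mul_le_mul_of_nonneg_left ?_ (hp M' hM')
        have maps : ∀ M ∈ P.filter (fun M => ∀ x ∈ S, e M x = e M' x),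
            (e M v).erase v ∈ Ys.filter
              (fun Y => Disjoint ((insert v Y).biUnion (e M')) S) := by
          intro M hM
          obtain ⟨hM, hr⟩ := Finset.mem_filter.1 hM
          refine Finset.mem_filter.2 ⟨hYs M hM, ?_⟩
          rw [Finset.insert_erase (he1 M hM v hv), Finset.disjoint_left]
          intro x hx hxS
          obtain ⟨y, hy, hxy⟩ := Finset.mem_biUnion.1 hx
          obtain ⟨hyV, hye⟩ := he2 M hM v hv y hy
          have h1 := (he2 M' hM' y hyV x hxy).2
          have h2 : y ∈ e M x := by rw [hr x hxS, h1]; exact he1 M' hM' y hyV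
          have h3 := (he2 M hM x (hSV x hxS) y h2).2
          have h4 := inv M' hM' M hM (fun x hx => (hr x hx).symm) hd'
          rw [Finset.disjoint_left] at h4
          exact h4 (by rw [← hye, h3]; exact he1 M hM x (hSV x hxS)) hxS
        rw [← Finset.sum_fiberwise_of_maps_to maps]
        refine Finset.sum_le_sum fun Y hY => ?_
        have hcls : ∀ M ∈ (P.filter (fun M => ∀ x ∈ S, e M x = e M' x)).filter
            (fun M => (e M v).erase v = Y),
            mcl P p e (insert v S) M = ∑ M ∈ (P.filter (fun M => ∀ x ∈ S, e M x = e M' x)).filter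
            (fun M => (e M v).erase v = Y), p M := by
          intro M hM
          obtain ⟨hM, hMY⟩ := Finset.mem_filter.1 hM
          obtain ⟨hM, hr⟩ := Finset.mem_filter.1 hM
          unfold mcl
          refine Finset.sum_congr ?_ fun _ _ => rfl
          ext N
          simp only [Finset.mem_filter, Finset.mem_insert, forall_eq_or_imp]
          constructor
          · rintro ⟨hN, h1, h2⟩
            exact ⟨⟨hN, fun x hx => (h2 x hx).trans (hr x hx)⟩, by rw [h1, hMY]⟩
          · rintro ⟨⟨hN, h1⟩, h2⟩
            refine ⟨hN, ?_, fun x hx => (h1 x hx).trans (hr x hx).symm⟩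
            rw [← Finset.insert_erase (he1 N hN v hv), ← Finset.insert_erase (he1 M hM v hv),
              h2, hMY]
        set C := ∑ M ∈ (P.filter (fun M => ∀ x ∈ S, e M x = e M' x)).filter
            (fun M => (e M v).erase v = Y), p M with hC
        have : ∑ M ∈ (P.filter (fun M => ∀ x ∈ S, e M x = e M' x)).filter
            (fun M => (e M v).erase v = Y),
              p M * w ((e M v).erase v) / mcl P p e (insert v S) M = C * (w Y / C) := by
          rw [hC, Finset.sum_mul, ← hC]
          refine Finset.sum_congr rfl fun M hM => ?_
          rw [hcls M hM, (Finset.mem_filter.1 hM).2]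
          ring
        rw [this]
        rcases eq_or_ne C 0 with h0 | h0
        · rw [h0]; simpa using hw Y
        · rw [mul_div_cancel₀ _ h0]

theorem step_ineq {α : Type} [DecidableEq α] (V : Finset ℕ) (P : Finset α) (p : α → ℝ)
    (e : α → ℕ → Finset ℕ) (hp : ∀ M ∈ P, 0 ≤ p M)
    (he1 : ∀ M ∈ P, ∀ v ∈ V, v ∈ e M v)
    (he2 : ∀ M ∈ P, ∀ v ∈ V, ∀ w ∈ e M v, w ∈ V ∧ e M w = e M v)
    (v : ℕ) (hv : v ∈ V) (S : Finset ℕ) (hS : S ⊆ V.erase v)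
    (w : Finset ℕ → ℝ) (hw : ∀ Y, 0 ≤ w Y)
    (hwp : ∀ M ∈ P, 0 < p M → 0 < w ((e M v).erase v))
    (Ys : Finset (Finset ℕ)) (hYs : ∀ M ∈ P, (e M v).erase v ∈ Ys) :
    hent P p e (insert v S) - hent P p e S ≤
      ∑ M ∈ P.filter (fun M => Disjoint (e M v) S),
        p M * (- Real.log (w ((e M v).erase v)) - 1 +
          ∑ Y ∈ Ys.filter (fun Y => Disjoint ((insert v Y).biUnion (e M)) S), w Y) := by
  have hSV : ∀ x ∈ S, x ∈ V := fun x hx => (Finset.mem_erase.1 (hS hx)).2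
  have key := key_ineq V P p e hp he1 he2 v hv S hS w hw Ys hYs
  have h1 : hent P p e (insert v S) - hent P p e S =
      ∑ M ∈ P, p M * (Real.log (mcl P p e S M) - Real.log (mcl P p e (insert v S) M)) := by
    unfold hent
    simp only [mul_sub, Finset.sum_sub_distrib]
    ring
  have h2 : ∑ M ∈ P, p M * (Real.log (mcl P p e S M) - Real.log (mcl P p e (insert v S) M))
     = ∑ M ∈ P.filter (fun M => Disjoint (e M v) S),
      p M * (Real.log (mcl P p e S M) - Real.log (mcl P p e (insert v S) M)) := by
    symm
    refine Finset.sum_subset (Finset.filter_subset _ _) ?_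
    intro M hM hnd
    have hnd : ¬ Disjoint (e M v) S := fun h => hnd (Finset.mem_filter.2 ⟨hM, h⟩)
    obtain ⟨x, hx, hxS⟩ := Finset.not_disjoint_iff.1 hnd
    have : mcl P p e S M = mcl P p e (insert v S) M := by
      unfold mcl
      refine Finset.sum_congr ?_ fun _ _ => rfl
      ext N
      simp only [Finset.mem_filter, Finset.mem_insert, forall_eq_or_imp]
      constructor
      · rintro ⟨hN, h⟩
        refine ⟨hN, ?_, h⟩
        have a1 := (he2 M hM v hv x hx).2
        have a2 := h x hxS
        have a3 : v ∈ e N x := by rw [a2, a1]; exact he1 M hM v hv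
        rw [(he2 N hN x (hSV x hxS) v a3).2, a2, a1]
      · rintro ⟨hN, _, h⟩
        exact ⟨hN, h⟩
    rw [this]; ring
  rw [h1, h2]
  have h3 : ∀ M ∈ P.filter (fun M => Disjoint (e M v) S),
      p M * (Real.log (mcl P p e S M) - Real.log (mcl P p e (insert v S) M)) ≤
      p M * (- Real.log (w ((e M v).erase v)) - 1) +
        p M * (w ((e M v).erase v) * mcl P p e S M / mcl P p e (insert v S) M) := by
    intro M hM
    have hM := (Finset.mem_filter.1 hM).1
    rcases (hp M hM).eq_or_lt with h0 | h0
    · rw [← h0]; simp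
    · rw [← mul_add]
      refine mul_le_mul_of_nonneg_left ?_ (hp M hM)
      have b1 := mcl_pos P p e hp S M hM h0
      have b2 := mcl_pos P p e hp (insert v S) M hM h0
      have b3 := hwp M hM h0
      have := Real.log_le_sub_one_of_pos (div_pos (mul_pos b3 b1) b2)
      rw [Real.log_div (mul_pos b3 b1).ne' b2.ne', Real.log_mul b3.ne' b1.ne'] at this
      linarith
  refine (Finset.sum_le_sum h3).trans ?_
  simp only [mul_add, Finset.sum_add_distrib]
  linarith

theorem bin_sum (V T : Finset ℕ) (v : ℕ) (hvT : v ∈ T) (hT : T ⊆ V) (t : ℝ) :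
    ∑ S ∈ (V.erase v).powerset.filter (fun S => Disjoint T S),
      t ^ S.card * (1 - t) ^ (V.card - 1 - S.card) = (1 - t) ^ (T.card - 1) := by
  have h : (V.erase v).powerset.filter (fun S => Disjoint T S) = (V \ T).powerset := by
    ext S
    simp only [Finset.mem_filter, Finset.mem_powerset, Finset.subset_sdiff]
    constructor
    · rintro ⟨h1, h2⟩
      exact ⟨h1.trans (Finset.erase_subset _ _), h2.symm⟩
    · rintro ⟨h1, h2⟩
      refine ⟨Finset.subset_erase.2 ⟨h1, fun h => ?_⟩, h2.symm⟩
      exact Finset.disjoint_left.1 h2 h hvT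
  rw [h]
  have hc := Finset.card_sdiff_add_card_eq_card hT
  have hT1 : 1 ≤ T.card := Finset.card_pos.2 ⟨v, hvT⟩
  have h2 : ∀ S ∈ (V \ T).powerset, t ^ S.card * (1 - t) ^ (V.card - 1 - S.card) =
      (t ^ S.card * (1 - t) ^ ((V \ T).card - S.card)) * (1 - t) ^ (T.card - 1) := by
    intro S hS
    have := Finset.card_le_card (Finset.mem_powerset.1 hS)
    rw [mul_assoc, ← pow_add]
    congr 2
    omega
  rw [Finset.sum_congr rfl h2, ← Finset.sum_mul, Finset.sum_pow_mul_eq_add_pow]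
  simp

/-- Averaged entropy. -/
def gavg (V : Finset ℕ) (h : Finset ℕ → ℝ) (t : ℝ) : ℝ :=
  ∑ S ∈ V.powerset, t ^ S.card * (1 - t) ^ (V.card - S.card) * h S

theorem gavg_zero (V : Finset ℕ) (h : Finset ℕ → ℝ) : gavg V h 0 = h ∅ := by
  unfold gavg
  rw [Finset.sum_eq_single ∅]
  · simp
  · intro S _ hS
    rw [zero_pow (Finset.card_ne_zero.2 (Finset.nonempty_iff_ne_empty.2 hS))]; simp
  · simp

theorem gavg_one (V : Finset ℕ) (h : Finset ℕ → ℝ) : gavg V h 1 = h V := by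
  unfold gavg
  rw [Finset.sum_eq_single V]
  · simp
  · intro S hS hne
    have := Finset.card_lt_card ((Finset.mem_powerset.1 hS).ssubset_of_ne hne)
    rw [sub_self, zero_pow (by omega)]; simp
  · simp

theorem gavg_deriv (V : Finset ℕ) (h : Finset ℕ → ℝ) (t : ℝ) :
    HasDerivAt (gavg V h) (∑ v ∈ V, ∑ S ∈ (V.erase v).powerset,
      t ^ S.card * (1 - t) ^ (V.card - 1 - S.card) * (h (insert v S) - h S)) t := by
  have h1 : HasDerivAt (gavg V h) (∑ S ∈ V.powerset,
      ((S.card * t ^ (S.card - 1)) * (1 - t) ^ (V.card - S.card) +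
        t ^ S.card * ((V.card - S.card : ℕ) * (1 - t) ^ (V.card - S.card - 1) * (-1))) * h S) t := by
    unfold gavg
    refine HasDerivAt.fun_sum fun S _ => ?_
    refine HasDerivAt.mul_const ?_ _
    refine HasDerivAt.mul (hasDerivAt_pow _ _) ?_
    exact HasDerivAt.fun_pow ((hasDerivAt_id t).const_sub 1) _
  convert h1 using 1
  simp only [mul_sub, Finset.sum_sub_distrib, add_mul, Finset.sum_add_distrib]
  rw [sub_eq_add_neg]
  congr 1
  · have : ∀ S ∈ V.powerset, S.card * t ^ (S.card - 1) * (1 - t) ^ (V.card - S.card) * h S =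
        ∑ v ∈ S, t ^ (S.card - 1) * (1 - t) ^ (V.card - S.card) * h S := by
      intro S _
      rw [Finset.sum_const, nsmul_eq_mul]; ring
    rw [Finset.sum_congr rfl this]
    have : ∑ S ∈ V.powerset, ∑ v ∈ S, t ^ (S.card - 1) * (1 - t) ^ (V.card - S.card) * h S
       = ∑ v ∈ V, ∑ S ∈ V.powerset.filter (fun S => v ∈ S),
          t ^ (S.card - 1) * (1 - t) ^ (V.card - S.card) * h S := by
      refine Finset.sum_comm' ?_
      intro S v
      simp only [Finset.mem_filter, Finset.mem_powerset]
      exact ⟨fun ⟨a, b⟩ => ⟨⟨a, b⟩, a b⟩, fun ⟨⟨a, b⟩, _⟩ => ⟨a, b⟩⟩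
    rw [this]
    refine Finset.sum_congr rfl fun v hv => ?_
    refine Finset.sum_bij' (fun S _ => insert v S) (fun S _ => S.erase v) ?_ ?_ ?_ ?_ ?_
    · intro S hS
      have hS := Finset.mem_powerset.1 hS
      simp only [Finset.mem_filter, Finset.mem_powerset, Finset.mem_insert_self, and_true]
      exact Finset.insert_subset hv (hS.trans (Finset.erase_subset _ _))
    · intro S hS
      simp only [Finset.mem_filter, Finset.mem_powerset] at hS
      exact Finset.mem_powerset.2 (Finset.erase_subset_erase _ hS.1)
    · intro S hS
      have hS := Finset.mem_powerset.1 hS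
      exact Finset.erase_insert (fun h => by simpa using hS h)
    · intro S hS
      exact Finset.insert_erase (Finset.mem_filter.1 hS).2
    · intro S hS
      have hS := Finset.mem_powerset.1 hS
      rw [Finset.card_insert_of_notMem (fun h => by simpa using hS h)]
      congr 3
      omega
  · rw [← Finset.sum_neg_distrib]
    have : ∀ S ∈ V.powerset, t ^ S.card * ((V.card - S.card : ℕ) *
        (1 - t) ^ (V.card - S.card - 1) * (-1)) * h S =
        ∑ v ∈ V \ S, -(t ^ S.card * (1 - t) ^ (V.card - 1 - S.card) * h S) := by
      intro S hS
      rw [Finset.sum_const, nsmul_eq_mul, Finset.card_sdiff_of_subset (Finset.mem_powerset.1 hS),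
        Nat.sub_right_comm]; ring
    rw [Finset.sum_congr rfl this]
    simp only [← Finset.sum_neg_distrib]
    refine Finset.sum_comm' ?_
    intro v S
    simp only [Finset.mem_powerset, Finset.mem_sdiff, Finset.subset_erase]
    tauto

theorem avg_ineq {α : Type} [DecidableEq α] (r : ℕ) (V : Finset ℕ) (P : Finset α) (p : α → ℝ)
    (e : α → ℕ → Finset ℕ) (hp : ∀ M ∈ P, 0 ≤ p M) (hp1 : ∑ M ∈ P, p M = 1)
    (he1 : ∀ M ∈ P, ∀ v ∈ V, v ∈ e M v)
    (he2 : ∀ M ∈ P, ∀ v ∈ V, ∀ w ∈ e M v, w ∈ V ∧ e M w = e M v)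
    (he3 : ∀ M ∈ P, ∀ v ∈ V, (e M v).card = r)
    (v : ℕ) (hv : v ∈ V)
    (Ys : Finset (Finset ℕ)) (hYs : ∀ M ∈ P, (e M v).erase v ∈ Ys)
    (hYV : ∀ Y ∈ Ys, Y ⊆ V)
    (bad : α → Finset ℕ → Prop) [∀ M Y, Decidable (bad M Y)]
    (hbad : ∀ M ∈ P, ∀ Y ∈ Ys, ¬ bad M Y →
      r + r * (r - 1) ≤ ((insert v Y).biUnion (e M)).card)
    (pY γ : Finset ℕ → ℝ)
    (hpY : ∀ Y, pY Y = ∑ M ∈ P.filter (fun M => (e M v).erase v = Y), p M)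
    (hγ : ∀ Y, γ Y = ∑ M ∈ P.filter (fun M => bad M Y), p M)
    (t : ℝ) (ht0 : 0 < t) (ht1 : t < 1) :
    ∑ S ∈ (V.erase v).powerset, t ^ S.card * (1 - t) ^ (V.card - 1 - S.card) *
        (hent P p e (insert v S) - hent P p e S) ≤
      (1 - t) ^ (r - 1) * ∑ Y ∈ Ys, (Real.negMulLog (pY Y) +
        pY Y * Real.log ((1 - t) ^ (r * (r - 1)) + γ Y)) := by
  have hs : 0 < 1 - t := by linarith
  have hpY0 : ∀ Y, 0 ≤ pY Y := fun Y => by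
    rw [hpY]; exact Finset.sum_nonneg fun M hM => hp M (Finset.mem_filter.1 hM).1
  have hγ0 : ∀ Y, 0 ≤ γ Y := fun Y => by
    rw [hγ]; exact Finset.sum_nonneg fun M hM => hp M (Finset.mem_filter.1 hM).1
  set a : Finset ℕ → ℝ := fun Y => (1 - t) ^ (r * (r - 1)) + γ Y with ha
  have ha0 : ∀ Y, 0 < a Y := fun Y => add_pos_of_pos_of_nonneg (pow_pos hs _) (hγ0 Y)
  set w : Finset ℕ → ℝ := fun Y => pY Y / a Y with hw
  have hw0 : ∀ Y, 0 ≤ w Y := fun Y => div_nonneg (hpY0 Y) (ha0 Y).le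
  have hpYpos : ∀ M ∈ P, 0 < p M → 0 < pY ((e M v).erase v) := by
    intro M hM h
    rw [hpY]
    refine lt_of_lt_of_le h ?_
    refine Finset.single_le_sum (f := p) (fun i hi => hp i (Finset.mem_filter.1 hi).1) ?_
    simp [hM]
  have hwp : ∀ M ∈ P, 0 < p M → 0 < w ((e M v).erase v) := by
    intro M hM h
    exact div_pos (hpYpos M hM h) (ha0 _)
  set wt : Finset ℕ → ℝ := fun S => t ^ S.card * (1 - t) ^ (V.card - 1 - S.card) with hwt
  have hwt0 : ∀ S, 0 ≤ wt S := fun S => by positivity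
  have hpYsum : ∑ Y ∈ Ys, pY Y = 1 := by
    simp only [hpY]
    rw [Finset.sum_fiberwise_of_maps_to hYs, hp1]
  -- step
  have A : ∑ S ∈ (V.erase v).powerset, wt S * (hent P p e (insert v S) - hent P p e S) ≤
      ∑ S ∈ (V.erase v).powerset, wt S * ∑ M ∈ P.filter (fun M => Disjoint (e M v) S),
        p M * (- Real.log (w ((e M v).erase v)) - 1 +
          ∑ Y ∈ Ys.filter (fun Y => Disjoint ((insert v Y).biUnion (e M)) S), w Y) := by
    refine Finset.sum_le_sum fun S hS => mul_le_mul_of_nonneg_left ?_ (hwt0 S)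
    exact step_ineq V P p e hp he1 he2 v hv S (Finset.mem_powerset.1 hS) w hw0 hwp Ys hYs
  refine A.trans ?_
  have heV : ∀ M ∈ P, ∀ x ∈ V, e M x ⊆ V := fun M hM x hx y hy => (he2 M hM x hx y hy).1
  -- swap
  have B : ∑ S ∈ (V.erase v).powerset, wt S * ∑ M ∈ P.filter (fun M => Disjoint (e M v) S),
        p M * (- Real.log (w ((e M v).erase v)) - 1 +
          ∑ Y ∈ Ys.filter (fun Y => Disjoint ((insert v Y).biUnion (e M)) S), w Y)
      = ∑ M ∈ P, p M * ((1 - t) ^ (r - 1) * (- Real.log (w ((e M v).erase v)) - 1)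
          + ∑ Y ∈ Ys, w Y * (1 - t) ^ (((insert v Y).biUnion (e M)).card - 1)) := by
    have B1 : ∀ S ∈ (V.erase v).powerset,
        wt S * ∑ M ∈ P.filter (fun M => Disjoint (e M v) S),
        p M * (- Real.log (w ((e M v).erase v)) - 1 +
          ∑ Y ∈ Ys.filter (fun Y => Disjoint ((insert v Y).biUnion (e M)) S), w Y)
        = ∑ M ∈ P, p M * ((if Disjoint (e M v) S then wt S else 0) *
            (- Real.log (w ((e M v).erase v)) - 1) + ∑ Y ∈ Ys, w Y *
            (if Disjoint ((insert v Y).biUnion (e M)) S then wt S else 0)) := by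
      intro S hS
      rw [Finset.sum_filter, Finset.mul_sum]
      refine Finset.sum_congr rfl fun M hM => ?_
      split_ifs with hd
      · rw [Finset.sum_filter]
        have : ∀ Y ∈ Ys, w Y *
            (if Disjoint ((insert v Y).biUnion (e M)) S then wt S else 0) =
            wt S * (if Disjoint ((insert v Y).biUnion (e M)) S then w Y else 0) := by
          intro Y _
          split_ifs <;> ring
        rw [Finset.sum_congr rfl this, ← Finset.mul_sum]
        ring
      · have : ∀ Y ∈ Ys, w Y *
            (if Disjoint ((insert v Y).biUnion (e M)) S then wt S else 0) = 0 := by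
          intro Y _
          rw [if_neg, mul_zero]
          intro h
          refine hd (h.mono_left ?_)
          exact Finset.subset_biUnion_of_mem (e M) (Finset.mem_insert_self v Y)
        rw [Finset.sum_eq_zero this]
        ring
    rw [Finset.sum_congr rfl B1, Finset.sum_comm]
    refine Finset.sum_congr rfl fun M hM => ?_
    rw [← Finset.mul_sum, Finset.sum_add_distrib, ← Finset.sum_mul, Finset.sum_comm,
      ← Finset.sum_filter, bin_sum V (e M v) v (he1 M hM v hv) (heV M hM v hv), he3 M hM v hv]
    congr 2
    refine Finset.sum_congr rfl fun Y hY => ?_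
    rw [← Finset.mul_sum, ← Finset.sum_filter, bin_sum V _ v]
    · exact Finset.mem_biUnion.2 ⟨v, Finset.mem_insert_self _ _, he1 M hM v hv⟩
    · refine Finset.biUnion_subset.2 fun x hx => heV M hM x ?_
      rcases Finset.mem_insert.1 hx with rfl | hx
      · exact hv
      · exact hYV Y hY hx
  rw [B]
  have hr1 : 1 ≤ r := by
    by_contra hcon
    have hP : P.Nonempty := by
      by_contra hP
      rw [Finset.not_nonempty_iff_eq_empty] at hP
      rw [hP] at hp1; simp at hp1
    obtain ⟨M, hM⟩ := hP
    have := Finset.card_pos.2 ⟨v, he1 M hM v hv⟩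
    rw [he3 M hM v hv] at this
    omega
  have C : ∀ M ∈ P, p M * ((1 - t) ^ (r - 1) * (- Real.log (w ((e M v).erase v)) - 1)
          + ∑ Y ∈ Ys, w Y * (1 - t) ^ (((insert v Y).biUnion (e M)).card - 1)) ≤
      (1 - t) ^ (r - 1) * (p M * (- Real.log (w ((e M v).erase v)) - 1)
          + ∑ Y ∈ Ys, w Y * (p M * ((1 - t) ^ (r * (r - 1)) + if bad M Y then 1 else 0))) := by
    intro M hM
    have : ∑ Y ∈ Ys, w Y * (1 - t) ^ (((insert v Y).biUnion (e M)).card - 1) ≤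
        ∑ Y ∈ Ys, w Y * ((1 - t) ^ (r - 1) *
          ((1 - t) ^ (r * (r - 1)) + if bad M Y then 1 else 0)) := by
      refine Finset.sum_le_sum fun Y hY => mul_le_mul_of_nonneg_left ?_ (hw0 Y)
      have hs1 : 1 - t ≤ 1 := by linarith
      split_ifs with hb
      · have : r ≤ ((insert v Y).biUnion (e M)).card := by
          rw [← he3 M hM v hv]
          exact Finset.card_le_card
            (Finset.subset_biUnion_of_mem (e M) (Finset.mem_insert_self v Y))
        have h1 : (1 - t) ^ (((insert v Y).biUnion (e M)).card - 1) ≤ (1 - t) ^ (r - 1) :=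
          pow_le_pow_of_le_one hs.le hs1 (by omega)
        have h2 : 0 ≤ (1 - t) ^ (r - 1) * (1 - t) ^ (r * (r - 1)) := by positivity
        linarith
      · rw [add_zero, ← pow_add]
        have := hbad M hM Y hY hb
        exact pow_le_pow_of_le_one hs.le hs1 (by omega)
    have h2 := mul_le_mul_of_nonneg_left this (hp M hM)
    have h3 : p M * ∑ Y ∈ Ys, w Y * ((1 - t) ^ (r - 1) *
          ((1 - t) ^ (r * (r - 1)) + if bad M Y then 1 else 0)) =
        (1 - t) ^ (r - 1) * ∑ Y ∈ Ys, w Y * (p M * ((1 - t) ^ (r * (r - 1)) +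
          if bad M Y then 1 else 0)) := by
      rw [Finset.mul_sum, Finset.mul_sum]
      refine Finset.sum_congr rfl fun Y _ => by ring
    rw [h3] at h2
    linarith
  refine (Finset.sum_le_sum C).trans ?_
  rw [← Finset.mul_sum]
  refine mul_le_mul_of_nonneg_left ?_ (pow_nonneg hs.le _)
  rw [Finset.sum_add_distrib, Finset.sum_comm]
  have D : ∑ Y ∈ Ys, ∑ M ∈ P, w Y * (p M * ((1 - t) ^ (r * (r - 1)) + if bad M Y then 1 else 0))
      = 1 := by
    refine Eq.trans ?_ hpYsum
    refine Finset.sum_congr rfl fun Y _ => ?_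
    rw [← Finset.mul_sum]
    have : ∑ M ∈ P, p M * ((1 - t) ^ (r * (r - 1)) + if bad M Y then 1 else 0) = a Y := by
      simp only [mul_add, Finset.sum_add_distrib, ← Finset.sum_mul, hp1, mul_ite, mul_one,
        mul_zero, ← Finset.sum_filter, ha, hγ, one_mul]
    rw [this, hw]
    exact div_mul_cancel₀ _ (ha0 Y).ne'
  rw [D]
  have E : ∑ M ∈ P, p M * (- Real.log (w ((e M v).erase v)) - 1) =
      ∑ Y ∈ Ys, (Real.negMulLog (pY Y) + pY Y * Real.log (a Y)) - 1 := by
    simp only [mul_sub, Finset.sum_sub_distrib, mul_one, hp1]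
    congr 1
    rw [← Finset.sum_fiberwise_of_maps_to hYs]
    refine Finset.sum_congr rfl fun Y _ => ?_
    have : ∀ M ∈ P.filter (fun M => (e M v).erase v = Y),
        p M * (- Real.log (w ((e M v).erase v))) = p M * (- Real.log (w Y)) := by
      intro M hM; rw [(Finset.mem_filter.1 hM).2]
    rw [Finset.sum_congr rfl this, ← Finset.sum_mul, ← hpY]
    rcases (hpY0 Y).eq_or_lt with h0 | h0
    · rw [← h0]; simp
    · rw [hw, Real.log_div h0.ne' (ha0 Y).ne', Real.negMulLog]
      ring
  rw [E]
  linarith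

end EntAux

/-- Antiderivative of `log (s^2 + δ^2)`. -/
noncomputable def phiAux (δ s : ℝ) : ℝ :=
  s * Real.log (s ^ 2 + δ ^ 2) - 2 * s + 2 * δ * Real.arctan (s / δ)

theorem phiAux_zero (δ : ℝ) : phiAux δ 0 = 0 := by
  simp [phiAux]

theorem phiAux_one (δ : ℝ) (h0 : 0 ≤ δ) (h1 : δ ≤ 1) : phiAux δ 1 ≤ -2 + 5 * δ := by
  unfold phiAux
  have a1 := Real.log_le_sub_one_of_pos (show 0 < 1 ^ 2 + δ ^ 2 by positivity)
  have a2 := (Real.arctan_lt_pi_div_two (1 / δ)).le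
  have a3 := Real.pi_lt_four
  have a4 : 2 * δ * Real.arctan (1 / δ) ≤ 2 * δ * 2 :=
    mul_le_mul_of_nonneg_left (by linarith) (by positivity)
  have a5 : δ ^ 2 ≤ δ := by nlinarith
  generalize Real.log (1 ^ 2 + δ ^ 2) = L at *
  generalize 2 * δ * Real.arctan (1 / δ) = K at *
  linarith

theorem phiAux_cont (δ : ℝ) : Continuous (phiAux δ) := by
  have h : Continuous (fun s : ℝ => s * Real.log (s ^ 2 + δ ^ 2)) := by
    rcases eq_or_ne δ 0 with rfl | h
    · have : (fun s : ℝ => s * Real.log (s ^ 2 + 0 ^ 2)) = fun s => 2 * (s * Real.log s) := by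
        funext s
        rw [zero_pow two_ne_zero, add_zero, Real.log_pow]
        push_cast; ring
      rw [this]
      exact continuous_const.mul Real.continuous_mul_log
    · refine continuous_id.mul (Continuous.log (by fun_prop) fun s => ?_)
      positivity
  have h2 : Continuous (fun s : ℝ => 2 * δ * Real.arctan (s / δ)) :=
    continuous_const.mul (Real.continuous_arctan.comp (continuous_id.div_const δ))
  exact (h.sub (by fun_prop)).add h2

theorem phiAux_deriv (δ s : ℝ) (hs : 0 < s) :
    HasDerivAt (phiAux δ) (Real.log (s ^ 2 + δ ^ 2)) s := by
  have hpos : 0 < s ^ 2 + δ ^ 2 := by positivity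
  have h1 : HasDerivAt (fun s : ℝ => s ^ 2 + δ ^ 2) (2 * s) s := by
    simpa using (hasDerivAt_pow 2 s).add_const (δ ^ 2)
  have h2 := (hasDerivAt_id s).mul (h1.log hpos.ne')
  have h3 := (hasDerivAt_id s).const_mul 2
  have h4 := (((hasDerivAt_id s).div_const δ).arctan).const_mul (2 * δ)
  have h5 := (h2.sub h3).add h4
  refine HasDerivAt.congr_deriv (f := phiAux δ) h5 ?_
  simp only [id]
  rcases eq_or_ne δ 0 with rfl | h
  · field_simp
    ring_nf
  · have : 1 + (s / δ) ^ 2 ≠ 0 := by positivity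
    field_simp
    ring

theorem log_bound (k : ℕ) (hk : 2 ≤ k) (s γ : ℝ) (hs : 0 < s) (hγ : 0 ≤ γ) :
    Real.log (s ^ k + γ) ≤
      (k : ℝ) / 2 * Real.log (s ^ 2 + (γ ^ ((1 : ℝ) / (k : ℝ))) ^ 2) := by
  set δ := γ ^ ((1 : ℝ) / (k : ℝ)) with hδ
  have hδ0 : 0 ≤ δ := Real.rpow_nonneg hγ _
  have hδk : γ = δ ^ k := by
    rw [hδ, one_div, Real.rpow_inv_natCast_pow hγ (by omega)]
  have hpos : 0 < s ^ 2 + δ ^ 2 := by positivity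
  have key : (s ^ k + γ) ^ 2 ≤ (s ^ 2 + δ ^ 2) ^ k := by
    rw [hδk]
    clear_value δ
    clear hδ hδk
    induction k, hk using Nat.le_induction with
    | base => rfl
    | succ k hk ih =>
      have e1 : (s ^ (k + 1) + δ ^ (k + 1)) ^ 2 ≤ (s ^ k + δ ^ k) ^ 2 * (s ^ 2 + δ ^ 2) := by
        have hc : 0 ≤ (s ^ k * δ - δ ^ k * s) ^ 2 := sq_nonneg _
        have hd : 0 ≤ s ^ k * δ ^ k * (s ^ 2 + δ ^ 2) := by positivity
        have ex : (s ^ k + δ ^ k) ^ 2 * (s ^ 2 + δ ^ 2) - (s ^ (k + 1) + δ ^ (k + 1)) ^ 2 =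
          (s ^ k * δ - δ ^ k * s) ^ 2 + 2 * (s ^ k * δ ^ k * (s ^ 2 + δ ^ 2)) := by ring
        linarith
      rw [pow_succ (s ^ 2 + δ ^ 2) k]
      exact e1.trans (mul_le_mul_of_nonneg_right ih hpos.le)
  have hp : 0 < s ^ k + γ := by positivity
  have := Real.log_le_log (by positivity) key
  rw [Real.log_pow, Real.log_pow] at this
  push_cast at this
  linarith

theorem edgeAt_eq {n : ℕ} {H : Finset (Finset ℕ)}
    {M : Finset (Finset ℕ)} (hM : M ∈ pmSet (Finset.range n) H) {A : Finset ℕ} (hA : A ∈ M)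
    {v : ℕ} (hv : v ∈ A) : edgeAt M v = A := by
  have hM' := (Finset.mem_filter.1 hM).2
  have : M.filter (fun A => v ∈ A) = {A} := by
    ext B
    simp only [Finset.mem_filter, Finset.mem_singleton]
    constructor
    · rintro ⟨hB, hvB⟩
      by_contra hne
      have := hM'.1 B hB A hA hne
      have hm : v ∈ B ∩ A := Finset.mem_inter.2 ⟨hvB, hv⟩
      rw [this] at hm
      simp at hm
    · rintro rfl
      exact ⟨hA, hv⟩
  unfold edgeAt
  rw [this]
  simp

theorem edgeAt_spec {n : ℕ} {H : Finset (Finset ℕ)}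
    {M : Finset (Finset ℕ)} (hM : M ∈ pmSet (Finset.range n) H)
    {v : ℕ} (hv : v ∈ Finset.range n) : edgeAt M v ∈ M ∧ v ∈ edgeAt M v := by
  have hM' := (Finset.mem_filter.1 hM).2
  rw [← hM'.2] at hv
  obtain ⟨A, hA, hvA⟩ := Finset.mem_biUnion.1 hv
  rw [edgeAt_eq hM hA hvA]
  exact ⟨hA, hvA⟩

theorem pm_card_bound {n r : ℕ} {H : Finset (Finset ℕ)} (hH : H ⊆ Kn n r)
    {M : Finset (Finset ℕ)} (hM : M ∈ pmSet (Finset.range n) H)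
    {v : ℕ} (hv : v ∈ Finset.range n) (Y : Finset ℕ)
    (hb : ¬ (M.filter (fun B => B ≠ edgeAt M v ∧ (B ∩ Y).Nonempty)).card < r - 1) :
    r + r * (r - 1) ≤ ((insert v Y).biUnion (edgeAt M)).card := by
  have hM' := Finset.mem_filter.1 hM
  have hMH : M ⊆ H := Finset.mem_powerset.1 hM'.1
  set Fs := M.filter (fun B => B ≠ edgeAt M v ∧ (B ∩ Y).Nonempty) with hFs
  have hsub : (insert (edgeAt M v) Fs).biUnion id ⊆ (insert v Y).biUnion (edgeAt M) := by
    intro x hx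
    obtain ⟨B, hB, hxB⟩ := Finset.mem_biUnion.1 hx
    rcases Finset.mem_insert.1 hB with rfl | hB
    · exact Finset.mem_biUnion.2 ⟨v, Finset.mem_insert_self _ _, hxB⟩
    · obtain ⟨hBM, _, y, hy⟩ := Finset.mem_filter.1 hB
      obtain ⟨hyB, hyY⟩ := Finset.mem_inter.1 hy
      refine Finset.mem_biUnion.2 ⟨y, Finset.mem_insert_of_mem hyY, ?_⟩
      rw [edgeAt_eq hM hBM hyB]
      exact hxB
  refine le_trans ?_ (Finset.card_le_card hsub)
  have hin : ∀ B ∈ insert (edgeAt M v) Fs, B ∈ M := by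
    intro B hB
    rcases Finset.mem_insert.1 hB with rfl | hB
    · exact (edgeAt_spec hM hv).1
    · exact (Finset.mem_filter.1 hB).1
  rw [Finset.card_biUnion]
  · have : ∀ B ∈ insert (edgeAt M v) Fs, (id B).card = r := fun B hB =>
      (Finset.mem_powersetCard.1 (hH (hMH (hin B hB)))).2
    rw [Finset.sum_congr rfl this, Finset.sum_const, smul_eq_mul,
      Finset.card_insert_of_notMem (by simp [hFs])]
    have h : r - 1 ≤ Fs.card := not_lt.1 hb
    nlinarith
  · intro A hA B hB hne
    exact Finset.disjoint_iff_inter_eq_empty.2 (hM'.2.1 A (hin A hA) B (hin B hB) hne)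

theorem pm_eq_image {n : ℕ} {H : Finset (Finset ℕ)} (hne : ∀ A ∈ H, A.Nonempty)
    {M : Finset (Finset ℕ)} (hM : M ∈ pmSet (Finset.range n) H) :
    M = (Finset.range n).image (edgeAt M) := by
  have hM' := Finset.mem_filter.1 hM
  have hMH : M ⊆ H := Finset.mem_powerset.1 hM'.1
  ext A
  simp only [Finset.mem_image]
  constructor
  · intro hA
    obtain ⟨x, hx⟩ := hne A (hMH hA)
    refine ⟨x, ?_, edgeAt_eq hM hA hx⟩
    rw [← hM'.2.2]
    exact Finset.mem_biUnion.2 ⟨A, hA, hx⟩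
  · rintro ⟨x, hx, rfl⟩
    exact (edgeAt_spec hM hx).1

/-- **Entropy bound for random perfect matchings (Theorem 8).** For a random perfect
matching `f` of an `r`-graph `H` on `[n]`,
`H(f) ≤ (1/r)·∑_v H(f(v)) − (r−1)n/r + c·(∑_v ∑_Y p_v(Y)·γ_v(Y)^{1/(r−1)} + log n)`. -/
theorem entropy_bound_random_pm (r : ℕ) (hr : 3 ≤ r) :
    ∃ c : ℝ, 0 < c ∧ ∀ n : ℕ, 2 ≤ n → r ∣ n →
      ∀ H : Finset (Finset ℕ), H ⊆ Kn n r → 0 < pmCount (Finset.range n) H →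
      ∀ p : Finset (Finset ℕ) → ℝ, (∀ M ∈ pmSet (Finset.range n) H, 0 ≤ p M) →
        (∑ M ∈ pmSet (Finset.range n) H, p M) = 1 →
        (∑ M ∈ pmSet (Finset.range n) H, Real.negMulLog (p M)) ≤
          (1 / r) *
              (∑ v ∈ Finset.range n,
                ∑ Y ∈ Finset.powersetCard (r - 1) ((Finset.range n).erase v),
                  Real.negMulLog (pv (Finset.range n) H p v Y))
            - ((r : ℝ) - 1) * n / r
            + c *
              ((∑ v ∈ Finset.range n,
                  ∑ Y ∈ Finset.powersetCard (r - 1) ((Finset.range n).erase v),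
                    pv (Finset.range n) H p v Y *
                      (gammav r (Finset.range n) H p v Y) ^ ((1 : ℝ) / ((r : ℝ) - 1)))
                + Real.log n) := by
  refine ⟨5 * r, by positivity, ?_⟩
  intro n hn _ H hH _ p hp hp1
  set V := Finset.range n with hV
  set P := pmSet V H with hP
  have hne : ∀ A ∈ H, A.Nonempty := by
    intro A hA
    have := (Finset.mem_powersetCard.1 (hH hA)).2
    exact Finset.card_pos.1 (by omega)
  have hMH : ∀ M ∈ P, M ⊆ H := fun M hM => Finset.mem_powerset.1 (Finset.mem_filter.1 hM).1
  have he1 : ∀ M ∈ P, ∀ v ∈ V, v ∈ edgeAt M v := fun M hM v hv => (edgeAt_spec hM hv).2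
  have heK : ∀ M ∈ P, ∀ v ∈ V, edgeAt M v ⊆ V ∧ (edgeAt M v).card = r := fun M hM v hv =>
    Finset.mem_powersetCard.1 (hH (hMH M hM (edgeAt_spec hM hv).1))
  have he2 : ∀ M ∈ P, ∀ v ∈ V, ∀ w ∈ edgeAt M v, w ∈ V ∧ edgeAt M w = edgeAt M v :=
    fun M hM v hv w hw => ⟨(heK M hM v hv).1 hw, edgeAt_eq hM (edgeAt_spec hM hv).1 hw⟩
  have he3 : ∀ M ∈ P, ∀ v ∈ V, (edgeAt M v).card = r := fun M hM v hv => (heK M hM v hv).2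
  have hYs : ∀ v ∈ V, ∀ M ∈ P,
      (edgeAt M v).erase v ∈ Finset.powersetCard (r - 1) (V.erase v) := by
    intro v hv M hM
    refine Finset.mem_powersetCard.2 ⟨Finset.erase_subset_erase _ (heK M hM v hv).1, ?_⟩
    rw [Finset.card_erase_of_mem (he1 M hM v hv), he3 M hM v hv]
  have hpv0 : ∀ v Y, 0 ≤ pv V H p v Y := fun v Y =>
    Finset.sum_nonneg fun M hM => hp M (Finset.mem_filter.1 hM).1
  have hγ0 : ∀ v Y, 0 ≤ gammav r V H p v Y := fun v Y =>
    Finset.sum_nonneg fun M hM => hp M (Finset.mem_filter.1 hM).1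
  have hγ1 : ∀ v Y, gammav r V H p v Y ≤ 1 := fun v Y => by
    rw [← hp1]
    exact Finset.sum_le_sum_of_subset_of_nonneg (Finset.filter_subset _ _)
      fun M hM _ => hp M hM
  have hpvsum : ∀ v ∈ V, ∑ Y ∈ Finset.powersetCard (r - 1) (V.erase v), pv V H p v Y = 1 := by
    intro v hv
    unfold pv
    rw [Finset.sum_fiberwise_of_maps_to (hYs v hv), hp1]
  set Ys : ℕ → Finset (Finset ℕ) := fun v => Finset.powersetCard (r - 1) (V.erase v) with hYsdef
  set δ : ℕ → Finset ℕ → ℝ := fun v Y => (gammav r V H p v Y) ^ ((1 : ℝ) / ((r : ℝ) - 1)) with hδ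
  have hδ0 : ∀ v Y, 0 ≤ δ v Y := fun v Y => Real.rpow_nonneg (hγ0 v Y) _
  have hr3 : (3 : ℝ) ≤ r := by exact_mod_cast hr
  have hδ1 : ∀ v Y, δ v Y ≤ 1 := fun v Y =>
    Real.rpow_le_one (hγ0 v Y) (hγ1 v Y) (by apply div_nonneg <;> linarith)
  have hcast : ((r - 1 : ℕ) : ℝ) = (r : ℝ) - 1 := by
    rw [Nat.cast_sub (by omega)]; simp
  -- the comparison function
  set Fc : ℝ → ℝ := fun t => ∑ v ∈ V, ∑ Y ∈ Ys v,
    (Real.negMulLog (pv V H p v Y) * (-(1 / r) * (1 - t) ^ r) +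
      pv V H p v Y * (-(1 / r) * (((r : ℝ) - 1) / 2 * phiAux (δ v Y) ((1 - t) ^ r)))) with hFc
  have hFcont : Continuous Fc := by
    refine continuous_finsetSum _ fun v _ => continuous_finsetSum _ fun Y _ => ?_
    have h1 : Continuous (fun t : ℝ => (1 - t) ^ r) := by fun_prop
    have h2 := (phiAux_cont (δ v Y)).comp h1
    exact (continuous_const.mul (continuous_const.mul h1)).add
      (continuous_const.mul (continuous_const.mul (continuous_const.mul h2)))
  have hFderiv : ∀ t : ℝ, t < 1 → HasDerivAt Fc (∑ v ∈ V, ∑ Y ∈ Ys v,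
      (Real.negMulLog (pv V H p v Y) * (1 - t) ^ (r - 1) +
      pv V H p v Y * ((1 - t) ^ (r - 1) * (((r : ℝ) - 1) / 2 *
        Real.log (((1 - t) ^ r) ^ 2 + (δ v Y) ^ 2))))) t := by
    intro t ht
    refine HasDerivAt.fun_sum fun v _ => HasDerivAt.fun_sum fun Y _ => ?_
    have h1 : HasDerivAt (fun t : ℝ => (1 - t) ^ r) (r * (1 - t) ^ (r - 1) * (-1)) t :=
      HasDerivAt.fun_pow ((hasDerivAt_id t).const_sub 1) _
    have hpos : 0 < (1 - t) ^ r := pow_pos (by linarith) _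
    have h2 := HasDerivAt.comp t (phiAux_deriv (δ v Y) _ hpos) h1
    have h3 := ((h1.const_mul (-(1 / (r : ℝ)))).const_mul (Real.negMulLog (pv V H p v Y))).add
      (((h2.const_mul (((r : ℝ) - 1) / 2)).const_mul (-(1 / (r : ℝ)))).const_mul (pv V H p v Y))
    refine HasDerivAt.congr_deriv h3 ?_
    have : (r : ℝ) ≠ 0 := by linarith
    field_simp
  set g := gavg V (hent P p edgeAt) with hg
  have hanti : AntitoneOn (fun t => g t - Fc t) (Set.Icc 0 1) := by
    have hd : ∀ t ∈ interior (Set.Icc (0 : ℝ) 1), HasDerivAt (fun t => g t - Fc t) _ t :=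
      fun t ht => (gavg_deriv V (hent P p edgeAt) t).sub
        (hFderiv t (by rw [interior_Icc] at ht; exact ht.2))
    refine antitoneOn_of_deriv_nonpos (convex_Icc 0 1) ?_ ?_ ?_
    · refine ContinuousOn.sub ?_ hFcont.continuousOn
      exact fun t _ => (gavg_deriv V (hent P p edgeAt) t).continuousAt.continuousWithinAt
    · exact fun t ht => (hd t ht).differentiableAt.differentiableWithinAt
    · intro t ht
      rw [(hd t ht).deriv, sub_nonpos]
      rw [interior_Icc] at ht
      refine Finset.sum_le_sum fun v hv => ?_
      refine (avg_ineq r V P p edgeAt hp hp1 he1 he2 he3 v hv (Ys v) (hYs v hv) ?_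
        (fun M Y => (M.filter (fun B => B ≠ edgeAt M v ∧ (B ∩ Y).Nonempty)).card < r - 1) ?_
        (pv V H p v) (gammav r V H p v) (fun _ => rfl) (fun _ => rfl) t ht.1 ht.2).trans ?_
      · intro Y hY
        exact (Finset.mem_powersetCard.1 hY).1.trans (Finset.erase_subset _ _)
      · intro M hM Y _ hb
        exact pm_card_bound hH hM hv Y hb
      · rw [Finset.mul_sum]
        refine Finset.sum_le_sum fun Y _ => ?_
        have hs : 0 < (1 - t) ^ r := pow_pos (by linarith [ht.2]) _
        have hs' : 0 ≤ (1 - t) ^ (r - 1) := pow_nonneg (by linarith [ht.2]) _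
        have hl := log_bound (r - 1) (by omega) _ (gammav r V H p v Y) hs (hγ0 v Y)
        rw [hcast, ← pow_mul] at hl
        have := mul_le_mul_of_nonneg_left hl (mul_nonneg hs' (hpv0 v Y))
        simp only [hδ]
        linarith
  have hfin := hanti (Set.left_mem_Icc.2 zero_le_one) (Set.right_mem_Icc.2 zero_le_one) zero_le_one
  simp only at hfin
  have hg1 : g 1 = ∑ M ∈ P, Real.negMulLog (p M) := by
    rw [hg, gavg_one, hent, ← Finset.sum_neg_distrib]
    refine Finset.sum_congr rfl fun M hM => ?_
    have : mcl P p edgeAt V M = p M := by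
      unfold mcl
      rw [Finset.sum_eq_single_of_mem M (by simp [hM])]
      intro N hN hNM
      obtain ⟨hN, hr⟩ := Finset.mem_filter.1 hN
      refine absurd ?_ hNM
      rw [pm_eq_image hne hN, pm_eq_image hne hM]
      refine Finset.image_congr fun x hx => ?_
      exact hr x (Finset.mem_coe.1 hx)
    rw [this, Real.negMulLog]; ring
  have hg0 : g 0 = 0 := by
    rw [hg, gavg_zero, hent]
    simp [mcl, hp1]
  have hF1 : Fc 1 = 0 := by
    simp only [hFc, sub_self, zero_pow (show r ≠ 0 by omega), phiAux_zero]
    simp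
  have hF0 : -Fc 0 ≤ (1 / r) * (∑ v ∈ V, ∑ Y ∈ Ys v, Real.negMulLog (pv V H p v Y))
      - ((r : ℝ) - 1) * n / r + 5 * r * ∑ v ∈ V, ∑ Y ∈ Ys v, pv V H p v Y * δ v Y := by
    have hn1 : (n : ℝ) = ∑ v ∈ V, ∑ Y ∈ Ys v, pv V H p v Y := by
      rw [Finset.sum_congr rfl hpvsum]; simp [hV]
    have hr0 : (0 : ℝ) < r := by linarith
    have : (1 / r) * (∑ v ∈ V, ∑ Y ∈ Ys v, Real.negMulLog (pv V H p v Y))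
      - ((r : ℝ) - 1) * n / r + 5 * r * ∑ v ∈ V, ∑ Y ∈ Ys v, pv V H p v Y * δ v Y =
      ∑ v ∈ V, ∑ Y ∈ Ys v, ((1 / r) * Real.negMulLog (pv V H p v Y) +
        pv V H p v Y * (-(((r : ℝ) - 1) / r) + 5 * r * δ v Y)) := by
      rw [mul_div_right_comm, hn1]
      simp only [Finset.mul_sum, ← Finset.sum_sub_distrib, ← Finset.sum_add_distrib]
      refine Finset.sum_congr rfl fun v _ => Finset.sum_congr rfl fun Y _ => by ring
    rw [this, hFc]
    simp only [← Finset.sum_neg_distrib]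
    refine Finset.sum_le_sum fun v _ => Finset.sum_le_sum fun Y _ => ?_
    have hph := phiAux_one (δ v Y) (hδ0 v Y) (hδ1 v Y)
    have h2 : 1 / r * (((r : ℝ) - 1) / 2 * phiAux (δ v Y) 1) ≤
        -(((r : ℝ) - 1) / r) + 5 * r * δ v Y := by
      have h3 : 1 / r * (((r : ℝ) - 1) / 2 * phiAux (δ v Y) 1) ≤
          1 / r * (((r : ℝ) - 1) / 2 * (-2 + 5 * δ v Y)) := by
        refine mul_le_mul_of_nonneg_left (mul_le_mul_of_nonneg_left hph ?_) (by positivity)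
        linarith
      have h4 : 1 / r * (((r : ℝ) - 1) / 2 * (-2 + 5 * δ v Y)) =
          -(((r : ℝ) - 1) / r) + (5 / 2 * (((r : ℝ) - 1) / r)) * δ v Y := by
        field_simp
      have h5 : ((r : ℝ) - 1) / r ≤ 1 := by rw [div_le_one hr0]; linarith
      have h6 : (5 / 2 * (((r : ℝ) - 1) / r)) * δ v Y ≤ 5 * r * δ v Y :=
        mul_le_mul_of_nonneg_right (by linarith) (hδ0 v Y)
      linarith
    have h7 := mul_le_mul_of_nonneg_left h2 (hpv0 v Y)
    rw [sub_zero, one_pow]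
    linarith
  have hlog : 0 ≤ 5 * (r : ℝ) * Real.log n :=
    mul_nonneg (by positivity) (Real.log_natCast_nonneg n)
  rw [hg1, hg0, hF1] at hfin
  rw [mul_add]
  linarith
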